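/- arXiv:1002.0747 — 2 statements merged into one kernel-verified Lean document; each statement's English description precedes it below -/
import Mathlib

section
/- In the coefficient process on a finite connected graph G with n vertices and diameter d, for every time t ≥ 2·n·d and all vertices u, v ∈ V: β_u(t) = β_v(t). That is, the process converges after at most 2·n·d iterations. -/
open Finset

/-- The coefficient process on a finite graph `G` (paper: Mossel–Tamuz,
"Efficient Bayesian Learning in Social Networks with Gaussian Estimators").
`β t v` is agent `v`'s coefficient vector at time `t`, encoding its unbiased
linear estimator `∑ w, (β t v) w * S w` of the state of the world; `U t v` is
the linear span of the estimators in agent `v`'s memory at time `t`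
(its own and its neighbors' estimators up to time `t`).
Initially `β 0 v = e_v`, and `β (t+1) v` is the unique minimal-norm vector of
the nonempty closed affine set `{x ∈ U t v : ∑ w, x w = 1}`; since that
minimizer exists and is unique, these fields determine the process uniquely. -/
structure CoeffProcess {V : Type*} [Fintype V] [DecidableEq V] (G : SimpleGraph V) where
  /-- agent `v`'s coefficient vector at time `t` -/
  β : ℕ → V → EuclideanSpace ℝ V
  /-- the span of the coefficient vectors observed by `v` up to time `t` -/
  U : ℕ → V → Submodule ℝ (EuclideanSpace ℝ V)
  init : ∀ v : V, β 0 v = EuclideanSpace.single v 1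
  span_eq : ∀ (t : ℕ) (v : V), U t v = Submodule.span ℝ
    {x : EuclideanSpace ℝ V | ∃ s ≤ t, ∃ u : V, (u = v ∨ G.Adj u v) ∧ x = β s u}
  mem_next : ∀ (t : ℕ) (v : V), β (t + 1) v ∈ U t v
  sum_next : ∀ (t : ℕ) (v : V), ∑ w, β (t + 1) v w = 1
  min_next : ∀ (t : ℕ) (v : V), ∀ x ∈ U t v, (∑ w, x w = 1) → ‖β (t + 1) v‖ ≤ ‖x‖

namespace CoeffProcess

variable {V : Type*} [Fintype V] [DecidableEq V] {G : SimpleGraph V} (P : CoeffProcess G)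

theorem sum_one (t : ℕ) (v : V) : ∑ w, P.β t v w = 1 := by
  cases t with
  | zero => rw [P.init]; simp [EuclideanSpace.single_apply]
  | succ t => exact P.sum_next t v

theorem mem_U {s t : ℕ} (hst : s ≤ t) {u v : V} (h : u = v ∨ G.Adj u v) :
    P.β s u ∈ P.U t v := by
  rw [P.span_eq]
  exact Submodule.subset_span ⟨s, hst, u, h, rfl⟩

theorem U_mono {s t : ℕ} (hst : s ≤ t) (v : V) : P.U s v ≤ P.U t v := by
  rw [P.span_eq, P.span_eq]
  apply Submodule.span_mono
  rintro x ⟨r, hr, u, h, rfl⟩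
  exact ⟨r, hr.trans hst, u, h, rfl⟩

theorem unique {t : ℕ} {v : V} {x : EuclideanSpace ℝ V} (hx : x ∈ P.U t v)
    (hs : ∑ w, x w = 1) (hn : ‖x‖ ≤ ‖P.β (t + 1) v‖) : x = P.β (t + 1) v := by
  set y := P.β (t + 1) v with hy
  have hm : (1 / 2 : ℝ) • (x + y) ∈ P.U t v :=
    Submodule.smul_mem _ _ (Submodule.add_mem _ hx (P.mem_next t v))
  have hsm : ∑ w, ((1 / 2 : ℝ) • (x + y)) w = 1 := by
    have h2 : ∑ w, y w = 1 := P.sum_next t v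
    simp only [PiLp.smul_apply, PiLp.add_apply, smul_eq_mul]
    rw [← Finset.mul_sum, Finset.sum_add_distrib, hs, h2]
    norm_num
  have h1 := P.min_next t v _ hm hsm
  rw [← hy, norm_smul] at h1
  have h3 : ‖(1 / 2 : ℝ)‖ = 1 / 2 := by norm_num
  rw [h3] at h1
  have h4 := parallelogram_law_with_norm ℝ x y
  have h5 := norm_nonneg x
  have h6 := norm_nonneg y
  have h7 : ‖x - y‖ * ‖x - y‖ ≤ 0 := by nlinarith
  have h8 : ‖x - y‖ = 0 := by nlinarith [norm_nonneg (x - y)]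
  exact sub_eq_zero.mp (norm_eq_zero.mp h8)

theorem persist {T : ℕ} {b : EuclideanSpace ℝ V} (h : ∀ w, P.β (T + 1) w = b) :
    ∀ s, T + 1 ≤ s → ∀ w, P.β s w = b := by
  intro s
  induction s using Nat.strong_induction_on with
  | _ s ih =>
    intro hs w
    rcases hs.eq_or_lt with rfl | hlt
    · exact h w
    obtain ⟨r, rfl⟩ : ∃ r, s = r + 1 := ⟨s - 1, by omega⟩
    have hU : P.U r w ≤ P.U T w := by
      rw [P.span_eq r w, Submodule.span_le]
      rintro x ⟨q, hq, u, hu, rfl⟩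
      by_cases hqT : q ≤ T
      · exact P.mem_U hqT hu
      · have := ih q (by omega) (by omega) u
        rw [this, ← h w]
        exact P.mem_next T w
    rw [← h w]
    exact P.unique (hU (P.mem_next r w)) (P.sum_next r w)
      (P.min_next r w _ (P.mem_U (by omega) (Or.inl rfl)) (P.sum_one _ _))

theorem window {t d : ℕ} {b : EuclideanSpace ℝ V} {a w : V} (p : G.Walk a w) :
    ∀ k, (∀ s, t + 1 + k ≤ s → s + k ≤ t + 2 * d + 1 → P.β s a = b) →
      ∀ s, t + 1 + (k + p.length) ≤ s → s + (k + p.length) ≤ t + 2 * d + 1 → P.β s w = b := by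
  induction p with
  | nil => intro k h; simpa using h
  | @cons u x y hadj p ih =>
    intro k h s h1 h2
    rw [SimpleGraph.Walk.length_cons] at h1 h2
    refine ih (k + 1) ?_ s (by omega) (by omega)
    intro s h1 h2
    obtain ⟨r, rfl⟩ : ∃ r, s = r + 1 := ⟨s - 1, by omega⟩
    have e1 := h r (by omega) (by omega)
    have e2 := h (r + 1 + 1) (by omega) (by omega)
    rw [← e2]
    refine P.unique (P.mem_U le_rfl (Or.inr hadj.symm)) (P.sum_one _ _) ?_
    rw [e2, ← e1]
    exact P.min_next r x _ (P.mem_U le_rfl (Or.inr hadj)) (P.sum_one _ _)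

theorem exists_stall (d : ℕ) (v : V) :
    ∃ k < Fintype.card V, P.U (2 * d * k) v = P.U (2 * d * (k + 1)) v := by
  by_contra! hne
  have key : ∀ k ≤ Fintype.card V, k + 1 ≤ Module.finrank ℝ (P.U (2 * d * k) v) := by
    intro k
    induction k with
    | zero =>
      intro _
      have h0 : P.U (2 * d * 0) v ≠ ⊥ := by
        intro hb
        have hm : P.β 0 v ∈ P.U (2 * d * 0) v := P.mem_U (by omega) (Or.inl rfl)
        rw [hb, Submodule.mem_bot] at hm
        have := P.sum_one 0 v
        rw [hm] at this
        simp at this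
      have := Submodule.one_le_finrank_iff.mpr h0
      omega
    | succ k ih =>
      intro hk
      have h1 := ih (by omega)
      have hlt : P.U (2 * d * k) v < P.U (2 * d * (k + 1)) v :=
        lt_of_le_of_ne (P.U_mono (Nat.mul_le_mul_left _ (by omega)) v) (hne k (by omega))
      have := Submodule.finrank_lt_finrank_of_lt hlt
      omega
  have h1 := key _ le_rfl
  have h2 := Submodule.finrank_le (P.U (2 * d * Fintype.card V) v)
  rw [finrank_euclideanSpace] at h2
  omega

end CoeffProcess

/-- In the coefficient process on a finite connected graph `G` with `n`
vertices and diameter `d`, for every time `t ≥ 2·n·d` and all vertices `u, v`: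
`β_u(t) = β_v(t)`. That is, the process converges after at most `2·n·d` iterations. -/
theorem coeff_process_converges_2nd {V : Type*} [Fintype V] [DecidableEq V]
    (G : SimpleGraph V) (hconn : G.Connected) (P : CoeffProcess G)
    (d : ℕ) (hd : G.diam = d)
    (t : ℕ) (ht : 2 * Fintype.card V * d ≤ t) (u v : V) :
    P.β t u = P.β t v := by
  have := hconn.nonempty
  have hdist : ∀ a b : V, G.dist a b ≤ d := by
    intro a b
    rw [← hd]
    exact SimpleGraph.dist_le_diam (SimpleGraph.connected_iff_ediam_ne_top.mp hconn)
  rcases Nat.eq_zero_or_pos d with h0 | hpos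
  · have h := hdist u v
    have : u = v := (hconn.dist_eq_zero_iff).mp (by omega)
    rw [this]
  obtain ⟨k, hk, hU⟩ := P.exists_stall d v
  set T := 2 * d * k with hT
  have hT' : 2 * d * (k + 1) = T + 2 * d := by rw [hT]; ring
  rw [hT'] at hU
  have base : ∀ s, T + 1 + 0 ≤ s → s + 0 ≤ T + 2 * d + 1 → P.β s v = P.β (T + 1) v := by
    intro s h1 h2
    obtain ⟨r, rfl⟩ : ∃ r, s = r + 1 := ⟨s - 1, by omega⟩
    refine P.unique ?_ (P.sum_one _ _) ?_
    · rw [hU]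
      exact P.U_mono (by omega) v (P.mem_next r v)
    · exact P.min_next r v _ (P.U_mono (by omega) v (P.mem_next T v)) (P.sum_one _ _)
  have hall : ∀ w, P.β (T + d + 1) w = P.β (T + 1) v := by
    intro w
    obtain ⟨p, hp⟩ := (hconn v w).exists_walk_length_eq_dist
    have hl := hdist v w
    exact P.window p 0 base (T + d + 1) (by omega) (by omega)
  have hle : T + d + 1 ≤ t := by
    have h1 : 2 * d * (k + 1) ≤ 2 * d * Fintype.card V := Nat.mul_le_mul_left _ hk
    have h2 : 2 * Fintype.card V * d = 2 * d * Fintype.card V := by ring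
    omega
  rw [P.persist hall t hle u, P.persist hall t hle v]
end

section
/- In the coefficient process on a finite connected graph G with n vertices and diameter d, for every time t ≥ 2·n·d and every vertex v ∈ V, the coefficient vector β_v(t) equals the uniform vector (1/n, …, 1/n), i.e., (β_v(t))_w = 1/n for every w ∈ V. Consequently every agent's estimator converges to the simple average (1/n)·∑_w S_w of the private signals, the information-theoretically optimal unbiased linear estimator. -/
open Finset

section helpers
variable {V : Type*} [Fintype V] [DecidableEq V] {G : SimpleGraph V}

lemma cp_sum (P : CoeffProcess G) (t : ℕ) (v : V) : ∑ w, P.β t v w = 1 := by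
  cases t with
  | zero => rw [P.init]; simp [Pi.single_apply]
  | succ t => exact P.sum_next t v

lemma cp_mem (P : CoeffProcess G) {s t : ℕ} (h : s ≤ t) {u v : V} (hu : u = v ∨ G.Adj u v) :
    P.β s u ∈ P.U t v := by
  rw [P.span_eq]; exact Submodule.subset_span ⟨s, h, u, hu, rfl⟩

lemma cp_mono (P : CoeffProcess G) {s t : ℕ} (h : s ≤ t) (v : V) : P.U s v ≤ P.U t v := by
  rw [P.span_eq s, P.span_eq t]
  apply Submodule.span_mono
  rintro x ⟨r, hr, u, hu, rfl⟩
  exact ⟨r, hr.trans h, u, hu, rfl⟩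

lemma cp_orth (P : CoeffProcess G) (t : ℕ) (v : V) (y : EuclideanSpace ℝ V)
    (hy : y ∈ P.U t v) (hs : ∑ w, y w = 1) :
    inner ℝ (P.β (t+1) v) (y - P.β (t+1) v) = 0 := by
  set b := P.β (t+1) v with hb
  set A := inner ℝ b (y - b) with hA
  set B := ‖y - b‖ ^ 2 with hB
  have hB0 : 0 ≤ B := by positivity
  have key : ∀ c : ℝ, 0 ≤ 2 * c * A + c ^ 2 * B := by
    intro c
    have h1 : ‖b‖ ≤ ‖b + c • (y - b)‖ := by
      apply P.min_next t v
      · exact Submodule.add_mem _ (P.mem_next t v)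
          (Submodule.smul_mem _ _ (Submodule.sub_mem _ hy (P.mem_next t v)))
      · have h2 := P.sum_next t v
        rw [← hb] at h2
        simp [Finset.sum_add_distrib, ← Finset.mul_sum, hs, h2]
    have h3 : ‖b + c • (y - b)‖ ^ 2 = ‖b‖ ^ 2 + (2 * c * A + c ^ 2 * B) := by
      rw [norm_add_sq_real, inner_smul_right, norm_smul, mul_pow, Real.norm_eq_abs, sq_abs]
      ring
    have h4 : ‖b‖ ^ 2 ≤ ‖b + c • (y - b)‖ ^ 2 := by gcongr
    linarith
  have h := key (-A / (B + 1))
  have hne : B + 1 ≠ 0 := by positivity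
  have h5 : 2 * (-A / (B + 1)) * A + (-A / (B + 1)) ^ 2 * B
      = - (A ^ 2 * (B + 2) / (B + 1) ^ 2) := by
    field_simp; ring
  rw [h5] at h
  by_contra hA0
  have : 0 < A ^ 2 * (B + 2) / (B + 1) ^ 2 := by positivity
  linarith

lemma cp_uniq (P : CoeffProcess G) (t : ℕ) (v : V) (y : EuclideanSpace ℝ V)
    (hy : y ∈ P.U t v) (hs : ∑ w, y w = 1) (hn : ‖y‖ ≤ ‖P.β (t+1) v‖) :
    y = P.β (t+1) v := by
  have h := cp_orth P t v y hy hs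
  have h2 : ‖P.β (t+1) v + (y - P.β (t+1) v)‖ ^ 2
      = ‖P.β (t+1) v‖ ^ 2 + ‖y - P.β (t+1) v‖ ^ 2 := by
    rw [norm_add_sq_real, h]; ring
  rw [add_sub_cancel] at h2
  have h3 : ‖y‖ ^ 2 ≤ ‖P.β (t+1) v‖ ^ 2 := by gcongr
  have h4 : ‖y - P.β (t+1) v‖ ^ 2 = 0 := le_antisymm (by linarith) (by positivity)
  exact sub_eq_zero.mp (norm_eq_zero.mp (pow_eq_zero_iff (by norm_num) |>.mp h4))

lemma cp_step (P : CoeffProcess G) (x : EuclideanSpace ℝ V) {u w : V} (huw : G.Adj u w)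
    {a b : ℕ} (ha : 1 ≤ a) (h : ∀ s, a ≤ s → s ≤ b → P.β s u = x) :
    ∀ s, a + 1 ≤ s → s + 1 ≤ b → P.β s w = x := by
  intro s h1 h2
  obtain ⟨c, rfl⟩ : ∃ c, b = c + 1 := ⟨b - 1, by omega⟩
  obtain ⟨r, rfl⟩ : ∃ r, s = r + 1 := ⟨s - 1, by omega⟩
  have hb := h (c+1) (by omega) le_rfl
  have haa := h a le_rfl (by omega)
  rw [← hb]
  apply cp_uniq P c u
  · exact cp_mem P (by omega) (Or.inr huw.symm)
  · exact cp_sum P _ _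
  · rw [hb, ← haa]
    exact P.min_next r w _ (cp_mem P (by omega) (Or.inr huw)) (cp_sum P _ _)

lemma cp_walk (P : CoeffProcess G) (x : EuclideanSpace ℝ V) {u w : V} (p : G.Walk u w) :
    ∀ a b : ℕ, 1 ≤ a → (∀ s, a ≤ s → s ≤ b → P.β s u = x) →
    ∀ s, a + p.length ≤ s → s + p.length ≤ b → P.β s w = x := by
  induction p with
  | nil => intro a b _ h s h1 h2; exact h s h1 h2
  | cons hadj p ih =>
    intro a b ha h s h1 h2
    rw [SimpleGraph.Walk.length_cons] at h1 h2
    refine ih (a+1) (b-1) (by omega) ?_ s (by omega) (by omega)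
    intro r hr1 hr2
    exact cp_step P x hadj ha h r hr1 (by omega)

lemma cp_claim (hconn : G.Connected) (P : CoeffProcess G) (v : V) (t : ℕ)
    (h : P.U t v = P.U (t + 2 * G.diam) v) (w : V) :
    P.β (t+1) v w = 1 / (Fintype.card V) := by
  set x := P.β (t+1) v with hx
  have hU : ∀ r, t ≤ r → r ≤ t + 2 * G.diam → P.U r v = P.U t v := fun r h1 h2 =>
    le_antisymm (by rw [h]; exact cp_mono P h2 v) (cp_mono P h1 v)
  have hc : ∀ s, t + 1 ≤ s → s ≤ t + 2 * G.diam + 1 → P.β s v = x := by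
    intro s h1 h2
    obtain ⟨r, rfl⟩ : ∃ r, s = r + 1 := ⟨s - 1, by omega⟩
    have hr := hU r (by omega) (by omega)
    apply cp_uniq P t v
    · rw [← hr]; exact P.mem_next r v
    · exact cp_sum P _ _
    · exact P.min_next r v _ (by rw [hr]; exact P.mem_next t v) (cp_sum P _ _)
  have : Nonempty V := ⟨v⟩
  have hall : ∀ u, x u = ‖x‖ ^ 2 := by
    intro u
    obtain ⟨p, hp⟩ := hconn.exists_walk_length_eq_dist v u
    have hd : G.dist v u ≤ G.diam :=
      SimpleGraph.dist_le_diam (SimpleGraph.connected_iff_ediam_ne_top.mp hconn)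
    have hxu := cp_walk P x p (t+1) (t + 2 * G.diam + 1) (by omega) hc (t + G.diam + 1)
      (by omega) (by omega)
    have ho := cp_orth P (t + G.diam) u (P.β 0 u) (cp_mem P (by omega) (Or.inl rfl))
      (cp_sum P _ _)
    rw [hxu, P.init, inner_sub_right, real_inner_self_eq_norm_sq] at ho
    rw [EuclideanSpace.inner_single_right] at ho
    simp at ho
    linarith
  have hsum := cp_sum P (t+1) v
  rw [← hx] at hsum
  simp only [hall] at hsum
  rw [hall w]
  simp at hsum
  have hn : (Fintype.card V : ℝ) ≠ 0 := by simp
  field_simp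
  linarith

lemma cp_persist (P : CoeffProcess G) (v : V) (s t : ℕ) (hst : s ≤ t)
    (h : ∀ w, P.β s v w = 1 / (Fintype.card V)) : 
    ∀ w, P.β t v w = 1 / (Fintype.card V) := by
  rcases hst.eq_or_lt with rfl | hlt
  · exact h
  obtain ⟨r, rfl⟩ : ∃ r, t = r + 1 := ⟨t - 1, by omega⟩
  have ho := cp_orth P r v (P.β s v) (cp_mem P (by omega) (Or.inl rfl)) (cp_sum P _ _)
  have hi : ∀ y : EuclideanSpace ℝ V, ∑ w, y w = 1 →
      inner ℝ y (P.β s v) = 1 / (Fintype.card V : ℝ) := by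
    intro y hy
    rw [PiLp.inner_apply]
    simp [h, ← Finset.mul_sum, hy]
  have e1 := hi _ (cp_sum P (r+1) v)
  have e2 := hi _ (cp_sum P s v)
  rw [inner_sub_right, e1, real_inner_self_eq_norm_sq] at ho
  rw [real_inner_self_eq_norm_sq] at e2
  have he : P.β s v = P.β (r+1) v := by
    apply cp_uniq P r v _ (cp_mem P (by omega) (Or.inl rfl)) (cp_sum P _ _)
    have : ‖P.β s v‖ ^ 2 ≤ ‖P.β (r+1) v‖ ^ 2 := by linarith
    exact le_of_sq_le_sq this (norm_nonneg _)
  rw [← he]; exact h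

lemma cp_exists (P : CoeffProcess G) (v : V) (m : ℕ) :
    ∃ k < Fintype.card V, P.U (k * m) v = P.U (k * m + m) v := by
  by_contra! hne
  have : ∀ k ≤ Fintype.card V, k + 1 ≤ Module.finrank ℝ (P.U (k * m) v) := by
    intro k
    induction k with
    | zero =>
      intro _
      rw [zero_add, Submodule.one_le_finrank_iff]
      intro hb
      have h1 : P.β 0 v ∈ P.U (0 * m) v := cp_mem P (by omega) (Or.inl rfl)
      rw [hb, Submodule.mem_bot] at h1
      have h2 := cp_sum P 0 v
      simp [h1] at h2
    | succ k ih =>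
      intro hk
      have h1 := ih (by omega)
      have h2 : P.U (k * m) v < P.U ((k+1) * m) v := by
        rw [add_mul, one_mul]
        exact lt_of_le_of_ne (cp_mono P (by omega) v) (hne k (by omega))
      have h3 := Submodule.finrank_lt_finrank_of_lt h2
      omega
  have h1 := this _ le_rfl
  have h2 := Submodule.finrank_le (P.U (Fintype.card V * m) v)
  rw [finrank_euclideanSpace] at h2
  omega

end helpers

/-- In the coefficient process on a finite connected graph `G` with `n`
vertices and diameter `d`, for every time `t ≥ 2·n·d` and every vertex `v`, the coefficient
vector `β_v(t)` equals the uniform vector `(1/n, …, 1/n)`. Consequently every agent's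
estimator converges to the simple average `(1/n)·∑_w S_w` of the private signals. -/
theorem coeff_process_converges_to_average {V : Type*} [Fintype V] [DecidableEq V]
    (G : SimpleGraph V) (hconn : G.Connected) (P : CoeffProcess G)
    (d : ℕ) (hd : G.diam = d)
    (t : ℕ) (ht : 2 * Fintype.card V * d ≤ t) (v : V) :
    (∀ w : V, P.β t v w = 1 / (Fintype.card V)) ∧
      ∀ S : V → ℝ, ∑ w, P.β t v w * S w = (∑ w, S w) / (Fintype.card V) := by
  have hmain : ∀ w : V, P.β t v w = 1 / (Fintype.card V) := by
    subst hd
    have : Nonempty V := ⟨v⟩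
    rcases Nat.eq_zero_or_pos G.diam with h0 | hpos
    · have hsub : Subsingleton V := by
        refine ⟨fun a b => ?_⟩
        have hd : G.dist a b ≤ G.diam :=
          SimpleGraph.dist_le_diam (SimpleGraph.connected_iff_ediam_ne_top.mp hconn)
        exact hconn.dist_eq_zero_iff.mp (by omega)
      apply cp_persist P v 0 t (Nat.zero_le _)
      intro w
      have hw : w = v := Subsingleton.elim _ _
      have hc : Fintype.card V = 1 :=
        le_antisymm (Fintype.card_le_one_iff_subsingleton.mpr hsub) Fintype.card_pos
      rw [P.init, hw, hc]; simp
    · obtain ⟨k, hk, he⟩ := cp_exists P v (2 * G.diam)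
      apply cp_persist P v (k * (2 * G.diam) + 1) t _ (cp_claim hconn P v _ he)
      have : (k + 1) * (2 * G.diam) ≤ Fintype.card V * (2 * G.diam) := by gcongr; omega
      nlinarith
  refine ⟨hmain, fun S => ?_⟩
  simp only [hmain, ← Finset.mul_sum]
  ring
end
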